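/- Let ψ⁰(x) = 2 log|cos(π x)| on the torus 𝕋. For every t ∈ ℝ, the limit lim_{n→∞} (1/n)·log Σ_{ω∈{0,1}^n} exp(t·sup_{x∈⟨ω⟩} ψ⁰_n(x)) exists (i.e. the topological pressure P_top(tψ⁰) is well defined) and equals max{(1−2t)·log 2, 0}. -/

import Mathlib

open MeasureTheory Filter Topology Set
open scoped ENNReal

noncomputable section

namespace GTM

abbrev Torus := AddCircle (1 : ℝ)

instance : Fact ((0:ℝ) < 1) := ⟨one_pos⟩

/-- The doubling map on the torus. -/
def dbl (x : Torus) : Torus := x + x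

/-- The function `x ↦ |cos (π x)|` lifted to the torus. -/
def absCos : Torus → ℝ :=
  Function.Periodic.lift (f := fun x : ℝ => |Real.cos (Real.pi * x)|)
    (by
      intro x
      simp [mul_add, mul_one, Real.cos_add_pi, abs_neg])

/-- The potential `ψ^c(x) = 2 log |cos (π (x - c))|`, with value `⊥ = -∞` at the
singularity `c + 1/2`. -/
def psi (c : Torus) (x : Torus) : EReal :=
  if absCos (x - c) = 0 then ⊥ else ((2 * Real.log (absCos (x - c)) : ℝ) : EReal)

/-- The Birkhoff sums `ψ^c_n` of the potential `ψ^c` under the doubling map. -/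
def psiSum (c : Torus) (n : ℕ) (x : Torus) : EReal :=
  ∑ k ∈ Finset.range n, psi c (dbl^[k] x)

/-- The left endpoint of the dyadic cylinder interval of a binary word. -/
def wordVal (n : ℕ) (ω : Fin n → Bool) : ℝ :=
  ∑ i : Fin n, (if ω i then (1 : ℝ) else 0) / 2 ^ ((i : ℕ) + 1)

/-- The closed dyadic interval `⟨ω⟩ ⊆ 𝕋` associated to a binary word `ω`. -/
def cyl (n : ℕ) (ω : Fin n → Bool) : Set Torus :=
  (fun x : ℝ => (x : Torus)) '' Set.Icc (wordVal n ω) (wordVal n ω + 1 / 2 ^ n)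

/-- The exponential function on extended reals, `exp ⊥ = 0`, `exp ⊤ = ∞`. -/
def eexp (x : EReal) : ℝ≥0∞ :=
  if x = ⊥ then 0 else if x = ⊤ then ⊤ else ENNReal.ofReal (Real.exp x.toReal)

/-- The logarithm on `ℝ≥0∞`, `log 0 = ⊥`, `log ∞ = ⊤`. -/
def elog (x : ℝ≥0∞) : EReal :=
  if x = 0 then ⊥ else if x = ⊤ then ⊤ else ((Real.log x.toReal : ℝ) : EReal)

/-- The partition function `Σ_{ω ∈ {0,1}ⁿ} exp (t · sup_{x ∈ ⟨ω⟩} ψ^c_n(x))`. -/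
def presZ (c : Torus) (t : ℝ) (n : ℕ) : ℝ≥0∞ :=
  ∑ ω : Fin n → Bool, eexp ((t : EReal) * ⨆ x ∈ cyl n ω, psiSum c n x)

/-- The upper topological pressure `P̄_top(t ψ^c)`. -/
def presUpper (c : Torus) (t : ℝ) : EReal :=
  atTop.limsup fun n : ℕ => (((n : ℝ)⁻¹ : ℝ) : EReal) * elog (presZ c t n)

/-- The lower topological pressure `P̲_top(t ψ^c)`. -/
def presLower (c : Torus) (t : ℝ) : EReal :=
  atTop.liminf fun n : ℕ => (((n : ℝ)⁻¹ : ℝ) : EReal) * elog (presZ c t n)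

/-- The product of the moduli `|cos (π 2ᵏ x)|` over `k < n`, whose logarithm is half the Birkhoff
sum of `ψ⁰`. -/
def cosProd (n : ℕ) (x : ℝ) : ℝ := ∏ k ∈ Finset.range n, |Real.cos (Real.pi * (2 ^ k * x))|

theorem cosProd_nonneg (n : ℕ) (x : ℝ) : 0 ≤ cosProd n x :=
  Finset.prod_nonneg fun _ _ => abs_nonneg _

theorem cosProd_le_one (n : ℕ) (x : ℝ) : cosProd n x ≤ 1 :=
  Finset.prod_le_one (fun _ _ => abs_nonneg _) fun _ _ => Real.abs_cos_le_one _

theorem cosProd_mul_sin (n : ℕ) (x : ℝ) :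
    cosProd n x * (2 ^ n * |Real.sin (Real.pi * x)|) = |Real.sin (Real.pi * (2 ^ n * x))| := by
  induction n with
  | zero => simp [cosProd]
  | succ n ih =>
    have h : Real.pi * (2 ^ (n + 1) * x) = 2 * (Real.pi * (2 ^ n * x)) := by ring
    rw [h, Real.sin_two_mul, abs_mul, abs_mul, ← ih, cosProd, Finset.prod_range_succ, ← cosProd,
      abs_two]
    ring

theorem dbl_iterate_coe (k : ℕ) (x : ℝ) : dbl^[k] (x : Torus) = ((2 ^ k * x : ℝ) : Torus) := by
  induction k with
  | zero => simp
  | succ k ih =>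
    rw [Function.iterate_succ_apply', ih, dbl, ← AddCircle.coe_add]
    congr 1
    ring

theorem psiSum_zero_coe (n : ℕ) (x : ℝ) :
    psiSum 0 n (x : Torus) =
      if cosProd n x = 0 then ⊥ else ((2 * Real.log (cosProd n x) : ℝ) : EReal) := by
  induction n with
  | zero => simp [psiSum, cosProd]
  | succ n ih =>
    have hcos : absCos (((2 ^ n * x : ℝ) : Torus) - 0) = |Real.cos (Real.pi * (2 ^ n * x))| := by
      rw [sub_zero]
      rfl
    have hprod : cosProd (n + 1) x = cosProd n x * |Real.cos (Real.pi * (2 ^ n * x))| :=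
      Finset.prod_range_succ _ _
    rw [psiSum, Finset.sum_range_succ, ← psiSum, ih, dbl_iterate_coe, psi, hcos, hprod]
    by_cases h₁ : cosProd n x = 0
    · simp [h₁]
    by_cases h₂ : |Real.cos (Real.pi * (2 ^ n * x))| = 0
    · simp [h₂]
    rw [if_neg h₁, if_neg h₂, if_neg (mul_ne_zero h₁ h₂), Real.log_mul h₁ h₂, ← EReal.coe_add]
    congr 1
    ring

/-- The distance, in units of `2⁻ⁿ`, from the `j`-th dyadic interval of level `n` to the
integers. -/
def edgeDist (n j : ℕ) : ℕ := min j (2 ^ n - 1 - j)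

theorem min_le_sin_pi_mul {x : ℝ} (h₀ : 0 ≤ x) (h₁ : x ≤ 1) :
    2 * min x (1 - x) ≤ Real.sin (Real.pi * x) := by
  have key : ∀ y : ℝ, 0 ≤ y → y ≤ 1 / 2 → 2 * y ≤ Real.sin (Real.pi * y) := by
    intro y hy₀ hy₁
    have := Real.mul_le_sin (x := Real.pi * y) (by positivity) (by nlinarith [Real.pi_pos])
    have e : 2 / Real.pi * (Real.pi * y) = 2 * y := by field_simp
    rwa [e] at this
  rcases le_total x (1 / 2) with h | h
  · rw [min_eq_left (by linarith)]
    exact key x h₀ h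
  · rw [min_eq_right (by linarith), ← Real.sin_pi_sub,
      show Real.pi - Real.pi * x = Real.pi * (1 - x) by ring]
    exact key _ (by linarith) (by linarith)

theorem abs_sin_pi_mul_le_min {x : ℝ} (h₀ : 0 ≤ x) (h₁ : x ≤ 1) :
    |Real.sin (Real.pi * x)| ≤ Real.pi * min x (1 - x) := by
  rw [mul_min_of_nonneg _ _ Real.pi_pos.le, le_min_iff]
  constructor
  · refine Real.abs_sin_le_abs.trans_eq (abs_of_nonneg (by positivity))
  · rw [← Real.sin_pi_sub, show Real.pi - Real.pi * x = Real.pi * (1 - x) by ring]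
    exact Real.abs_sin_le_abs.trans_eq
      (abs_of_nonneg (mul_nonneg Real.pi_pos.le (by linarith)))

theorem cast_compl {n j : ℕ} (hj : j < 2 ^ n) : ((2 ^ n - 1 - j : ℕ) : ℝ) = 2 ^ n - 1 - j := by
  have : j + 1 ≤ 2 ^ n := hj
  rw [Nat.sub_sub, add_comm, Nat.cast_sub this]
  push_cast
  ring

theorem cosProd_le_inv {n j : ℕ} (hj : j < 2 ^ n) {x : ℝ}
    (hx : x ∈ Icc ((j : ℝ) / 2 ^ n) (j / 2 ^ n + 1 / 2 ^ n)) :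
    cosProd n x ≤ ((edgeDist n j : ℝ) + 1)⁻¹ := by
  rcases Nat.eq_zero_or_pos (edgeDist n j) with h | h
  · simpa [h] using cosProd_le_one n x
  have hN : (0 : ℝ) < 2 ^ n := by positivity
  obtain ⟨hx₀, hx₁⟩ := hx
  rw [← add_div] at hx₁
  rw [div_le_iff₀ hN] at hx₀
  rw [le_div_iff₀ hN] at hx₁
  have hm₁ : (edgeDist n j : ℝ) ≤ j := by exact_mod_cast min_le_left _ _
  have hm₂ : (edgeDist n j : ℝ) ≤ 2 ^ n - 1 - j := by
    rw [← cast_compl hj]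
    exact_mod_cast min_le_right _ _
  have hm : (1 : ℝ) ≤ edgeDist n j := by exact_mod_cast h
  have hpos : 0 ≤ x := by
    by_contra! hneg
    nlinarith
  have hle : x ≤ 1 := by
    by_contra! hgt
    nlinarith
  have hmin : (edgeDist n j : ℝ) ≤ 2 ^ n * min x (1 - x) := by
    rw [mul_min_of_nonneg _ _ hN.le, le_min_iff]
    constructor <;> linarith
  have hsin := (min_le_sin_pi_mul hpos hle).trans (le_abs_self _)
  have hprod := (cosProd_mul_sin n x).trans_le (Real.abs_sin_le_one _)
  have hbound : (edgeDist n j : ℝ) + 1 ≤ 2 ^ n * |Real.sin (Real.pi * x)| := by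
    nlinarith
  rw [← one_div, le_div_iff₀ (by positivity)]
  exact (mul_le_mul_of_nonneg_left hbound (cosProd_nonneg n x)).trans hprod

theorem inv_le_cosProd_midpoint {n j : ℕ} (hj : j < 2 ^ n) :
    (Real.pi * ((edgeDist n j : ℝ) + 1))⁻¹ ≤ cosProd n (((j : ℝ) + 1 / 2) / 2 ^ n) := by
  have hN : (0 : ℝ) < 2 ^ n := by positivity
  set x : ℝ := ((j : ℝ) + 1 / 2) / 2 ^ n with hx
  have hNx : 2 ^ n * x = (j : ℝ) + 1 / 2 := by
    rw [hx]
    field_simp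
  have hjN : (j : ℝ) + 1 ≤ 2 ^ n := by exact_mod_cast hj
  have hpos : 0 ≤ x := by positivity
  have hle : x ≤ 1 := by
    rw [hx, div_le_one hN]
    linarith
  have hmin : 2 ^ n * min x (1 - x) ≤ (edgeDist n j : ℝ) + 1 := by
    rw [mul_min_of_nonneg _ _ hN.le, edgeDist, Nat.cast_min, cast_compl hj, ← min_add_add_right]
    exact min_le_min (by linarith) (by linarith)
  have hone : |Real.sin (Real.pi * (2 ^ n * x))| = 1 := by
    rw [hNx, show Real.pi * ((j : ℝ) + 1 / 2) = Real.pi / 2 + j * Real.pi by ring,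
      Real.sin_add_nat_mul_pi]
    simp
  have hprod := cosProd_mul_sin n x
  rw [hone] at hprod
  have hsin := abs_sin_pi_mul_le_min hpos hle
  have hbound : 2 ^ n * |Real.sin (Real.pi * x)| ≤ Real.pi * ((edgeDist n j : ℝ) + 1) := by
    nlinarith [mul_le_mul_of_nonneg_left hsin hN.le, mul_le_mul_of_nonneg_left hmin Real.pi_pos.le]
  rw [← one_div, div_le_iff₀ (by positivity)]
  exact hprod.symm.trans_le <| mul_le_mul_of_nonneg_left hbound (cosProd_nonneg n x)

theorem exists_iSup_psiSum_eq {n j : ℕ} (hj : j < 2 ^ n) :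
    ∃ s : ℝ, (⨆ x ∈ (fun x : ℝ => (x : Torus)) '' Icc ((j : ℝ) / 2 ^ n) (j / 2 ^ n + 1 / 2 ^ n),
        psiSum 0 n x) = (s : EReal) ∧
      |s + 2 * Real.log ((edgeDist n j : ℝ) + 1)| ≤ 2 * Real.log Real.pi := by
  set m : ℝ := (edgeDist n j : ℝ) + 1 with hm
  have hm₀ : 0 < m := by positivity
  set S := ⨆ x ∈ (fun x : ℝ => (x : Torus)) '' Icc ((j : ℝ) / 2 ^ n) (j / 2 ^ n + 1 / 2 ^ n),
        psiSum 0 n x with hS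
  have hupper : S ≤ ((-(2 * Real.log m) : ℝ) : EReal) := by
    refine iSup₂_le ?_
    rintro _ ⟨x, hx, rfl⟩
    rw [psiSum_zero_coe]
    split_ifs with h
    · exact bot_le
    · have hlog := Real.log_le_log ((cosProd_nonneg n x).lt_of_ne' h) (cosProd_le_inv hj hx)
      rw [Real.log_inv] at hlog
      exact EReal.coe_le_coe_iff.2 (by linarith)
  have hlower : ((-(2 * Real.log Real.pi) - 2 * Real.log m : ℝ) : EReal) ≤ S := by
    have hx : ((j : ℝ) + 1 / 2) / 2 ^ n ∈ Icc ((j : ℝ) / 2 ^ n) (j / 2 ^ n + 1 / 2 ^ n) := by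
      rw [← add_div]
      constructor <;> gcongr <;> linarith
    refine le_trans ?_ (le_iSup₂_of_le _ (mem_image_of_mem _ hx) le_rfl)
    have hinv := inv_le_cosProd_midpoint hj
    have hpos : 0 < (Real.pi * m)⁻¹ := inv_pos.2 (mul_pos Real.pi_pos hm₀)
    have hlog := Real.log_le_log hpos hinv
    rw [Real.log_inv, Real.log_mul Real.pi_ne_zero hm₀.ne'] at hlog
    rw [psiSum_zero_coe, if_neg (hpos.trans_le hinv).ne']
    exact EReal.coe_le_coe_iff.2 (by linarith)
  have htop : S ≠ ⊤ := (hupper.trans_lt (EReal.coe_lt_top _)).ne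
  have hbot : S ≠ ⊥ := ((EReal.bot_lt_coe _).trans_le hlower).ne'
  lift S to ℝ using ⟨htop, hbot⟩ with s
  refine ⟨s, rfl, ?_⟩
  rw [EReal.coe_le_coe_iff] at hupper hlower
  have := Real.log_nonneg (by linarith [Real.pi_gt_three] : 1 ≤ Real.pi)
  exact abs_le.2 ⟨by linarith, by linarith⟩

theorem wordVal_cons (n : ℕ) (b : Bool) (ω : Fin n → Bool) :
    wordVal (n + 1) (Fin.cons b ω : Fin (n + 1) → Bool) =
      ((if b then 1 else 0) + wordVal n ω) / 2 := by
  simp only [wordVal, Fin.sum_univ_succ, Fin.cons_zero, Fin.cons_succ, Fin.val_zero, Fin.val_succ,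
    add_div, Finset.sum_div]
  congr 1
  · simp
  · refine Finset.sum_congr rfl fun i _ => ?_
    rw [pow_succ _ ((i : ℕ) + 1), div_div]

theorem sum_wordVal {M : Type*} [AddCommMonoid M] (n : ℕ) (g : ℝ → M) :
    ∑ ω : Fin n → Bool, g (wordVal n ω) = ∑ j ∈ Finset.range (2 ^ n), g ((j : ℝ) / 2 ^ n) := by
  induction n generalizing g with
  | zero => simp [wordVal]
  | succ n ih =>
    rw [← (Fin.consEquiv fun _ : Fin (n + 1) => Bool).sum_comp, Fintype.sum_prod_type,
      Fintype.sum_bool, add_comm]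
    have hb : ∀ b : Bool,
        ∑ ω : Fin n → Bool, g (wordVal (n + 1) (Fin.consEquiv (fun _ => Bool) (b, ω))) =
          ∑ j ∈ Finset.range (2 ^ n), g (((if b then 1 else 0) + (j : ℝ) / 2 ^ n) / 2) := by
      intro b
      rw [← ih fun x => g (((if b then 1 else 0) + x) / 2)]
      exact Finset.sum_congr rfl fun ω _ => congrArg g (wordVal_cons n b ω)
    rw [hb, hb, show 2 ^ (n + 1) = 2 ^ n + 2 ^ n by ring, Finset.sum_range_add]
    congr 1 <;> refine Finset.sum_congr rfl fun j _ => congrArg g ?_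
    · simp [pow_succ, div_div]
    · rw [if_pos rfl]
      push_cast
      field_simp
      ring

/-- The truncated Dirichlet series `∑_{m = 1}^{2ⁿ} m^{-2t}`. -/
def dirichletSum (t : ℝ) (n : ℕ) : ℝ :=
  ∑ j ∈ Finset.range (2 ^ n), Real.exp (-(2 * t) * Real.log ((j : ℝ) + 1))

/-- The exponential growth rate of `dirichletSum`. -/
def rate (t : ℝ) : ℝ := max ((1 - 2 * t) * Real.log 2) 0

theorem abs_block_exponent_le (t : ℝ) {n j : ℕ} (hj : j < 2 ^ n) :
    |-(2 * t) * Real.log (((2 ^ n + j : ℕ) : ℝ) + 1) + 2 * t * (n * Real.log 2)| ≤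
      2 * |t| * Real.log 2 := by
  have hlo : (n : ℝ) * Real.log 2 ≤ Real.log (((2 ^ n + j : ℕ) : ℝ) + 1) := by
    rw [← Real.log_pow]
    refine Real.log_le_log (by positivity) ?_
    push_cast
    linarith [(Nat.cast_nonneg j : (0 : ℝ) ≤ j)]
  have hhi : Real.log (((2 ^ n + j : ℕ) : ℝ) + 1) ≤ ((n + 1 : ℕ) : ℝ) * Real.log 2 := by
    rw [← Real.log_pow]
    refine Real.log_le_log (by positivity) ?_
    have : (j : ℝ) + 1 ≤ 2 ^ n := by exact_mod_cast hj
    push_cast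
    rw [pow_succ]
    linarith
  push_cast at hhi hlo ⊢
  rw [show ∀ L : ℝ, -(2 * t) * L + 2 * t * (n * Real.log 2) = -(2 * t) * (L - n * Real.log 2) by
    intro L; ring, abs_mul, abs_neg, abs_mul, abs_two]
  refine mul_le_mul_of_nonneg_left ?_ (by positivity)
  rw [abs_of_nonneg (by linarith)]
  linarith

theorem dirichletSum_succ (t : ℝ) (n : ℕ) :
    dirichletSum t (n + 1) = dirichletSum t n + ∑ j ∈ Finset.range (2 ^ n),
      Real.exp (-(2 * t) * Real.log (((2 ^ n + j : ℕ) : ℝ) + 1)) := by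
  rw [dirichletSum, pow_succ, mul_two, Finset.sum_range_add, ← dirichletSum]

theorem two_pow_mul_exp (t c : ℝ) (n : ℕ) :
    2 ^ n * Real.exp (-(2 * t) * (n * Real.log 2) + c) =
      Real.exp (n * ((1 - 2 * t) * Real.log 2) + c) := by
  have : (2 : ℝ) ^ n = Real.exp (n * Real.log 2) := by
    rw [Real.exp_nat_mul, Real.exp_log two_pos]
  rw [this, ← Real.exp_add]
  ring_nf

theorem dirichletSum_le (t : ℝ) (n : ℕ) :
    dirichletSum t n ≤ (n + 1) * Real.exp (n * rate t + 2 * |t| * Real.log 2) := by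
  have hlog := Real.log_pos one_lt_two
  have hrate : 0 ≤ rate t := le_max_right _ _
  induction n with
  | zero =>
    simp only [dirichletSum, pow_zero, Finset.sum_range_one, Nat.cast_zero, zero_add, Real.log_one,
      mul_zero, zero_mul, one_mul]
    exact Real.exp_le_exp.2 (by positivity)
  | succ n ih =>
    rw [dirichletSum_succ]
    have hblock : ∑ j ∈ Finset.range (2 ^ n),
        Real.exp (-(2 * t) * Real.log (((2 ^ n + j : ℕ) : ℝ) + 1)) ≤
          Real.exp (n * rate t + 2 * |t| * Real.log 2) := by
      calc _ ≤ ∑ j ∈ Finset.range (2 ^ n),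
            Real.exp (-(2 * t) * (n * Real.log 2) + 2 * |t| * Real.log 2) := by
            refine Finset.sum_le_sum fun j hj => Real.exp_le_exp.2 ?_
            linarith [(abs_le.1 (abs_block_exponent_le t (Finset.mem_range.1 hj))).2]
        _ = Real.exp (n * ((1 - 2 * t) * Real.log 2) + 2 * |t| * Real.log 2) := by
            rw [Finset.sum_const, Finset.card_range, nsmul_eq_mul, ← two_pow_mul_exp]
            push_cast
            rfl
        _ ≤ _ := by
            gcongr
            exact le_max_left _ _
    have hmono : Real.exp (n * rate t + 2 * |t| * Real.log 2) ≤
        Real.exp ((n + 1 : ℕ) * rate t + 2 * |t| * Real.log 2) := by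
      gcongr
      exact Nat.le_succ n
    rw [Nat.cast_succ] at hmono ⊢
    have hn : (0 : ℝ) ≤ n + 1 := by positivity
    nlinarith [mul_le_mul_of_nonneg_left hmono hn]

theorem le_dirichletSum_succ (t : ℝ) (n : ℕ) :
    Real.exp (n * rate t - 2 * |t| * Real.log 2) ≤ dirichletSum t (n + 1) := by
  have hlog := Real.log_pos one_lt_two
  rcases le_total ((1 - 2 * t) * Real.log 2) 0 with h | h
  · rw [rate, max_eq_right h]
    have hone : (1 : ℝ) ≤ dirichletSum t (n + 1) := by
      have := Finset.single_le_sum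
        (f := fun j : ℕ => Real.exp (-(2 * t) * Real.log ((j : ℝ) + 1)))
        (fun _ _ => (Real.exp_pos _).le) (Finset.mem_range.2 (Nat.two_pow_pos (n + 1)))
      simpa [dirichletSum] using this
    refine le_trans (Real.exp_le_one_iff.2 ?_) hone
    have : 0 ≤ 2 * |t| * Real.log 2 := by positivity
    linarith
  · rw [rate, max_eq_left h, dirichletSum_succ]
    have hnonneg : 0 ≤ dirichletSum t n := Finset.sum_nonneg fun _ _ => (Real.exp_pos _).le
    refine le_trans ?_ (le_add_of_nonneg_left hnonneg)
    calc _ = ∑ j ∈ Finset.range (2 ^ n),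
            Real.exp (-(2 * t) * (n * Real.log 2) + -(2 * |t| * Real.log 2)) := by
            rw [Finset.sum_const, Finset.card_range, nsmul_eq_mul, sub_eq_add_neg,
              ← two_pow_mul_exp]
            push_cast
            rfl
      _ ≤ _ := by
            refine Finset.sum_le_sum fun j hj => Real.exp_le_exp.2 ?_
            linarith [(abs_le.1 (abs_block_exponent_le t (Finset.mem_range.1 hj))).1]

/-- The model partition function, with each supremum replaced by its order of magnitude. -/
def edgeSum (t : ℝ) (n : ℕ) : ℝ :=
  ∑ j ∈ Finset.range (2 ^ n), Real.exp (-(2 * t) * Real.log ((edgeDist n j : ℝ) + 1))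

theorem edgeSum_le (t : ℝ) (n : ℕ) : edgeSum t n ≤ 2 * dirichletSum t n := by
  have hreflect : dirichletSum t n = ∑ j ∈ Finset.range (2 ^ n),
      Real.exp (-(2 * t) * Real.log (((2 ^ n - 1 - j : ℕ) : ℝ) + 1)) :=
    (Finset.sum_range_reflect
      (fun j : ℕ => Real.exp (-(2 * t) * Real.log ((j : ℝ) + 1))) (2 ^ n)).symm
  rw [two_mul]
  nth_rewrite 2 [hreflect]
  rw [dirichletSum, ← Finset.sum_add_distrib]
  refine Finset.sum_le_sum fun j _ => ?_
  rcases min_choice j (2 ^ n - 1 - j) with h | h <;> rw [edgeDist, h]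
  · exact le_add_of_nonneg_right (Real.exp_pos _).le
  · exact le_add_of_nonneg_left (Real.exp_pos _).le

theorem dirichletSum_le_edgeSum_succ (t : ℝ) (n : ℕ) :
    dirichletSum t n ≤ edgeSum t (n + 1) := by
  have hsub : Finset.range (2 ^ n) ⊆ Finset.range (2 ^ (n + 1)) :=
    Finset.range_subset_range.2 (Nat.pow_le_pow_right two_pos n.le_succ)
  refine le_trans (le_of_eq ?_)
    (Finset.sum_le_sum_of_subset_of_nonneg hsub fun _ _ _ => (Real.exp_pos _).le)
  refine Finset.sum_congr rfl fun j hj => ?_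
  have hj := Finset.mem_range.1 hj
  rw [edgeDist, min_eq_left (by rw [pow_succ]; omega)]

theorem exists_presZ_eq (t : ℝ) (n : ℕ) :
    ∃ z : ℝ, presZ 0 t n = ENNReal.ofReal z ∧
      Real.exp (-(2 * |t| * Real.log Real.pi)) * edgeSum t n ≤ z ∧
      z ≤ Real.exp (2 * |t| * Real.log Real.pi) * edgeSum t n := by
  have hsup : ∀ j : ℕ, ∃ s : ℝ, j < 2 ^ n →
      (⨆ x ∈ (fun x : ℝ => (x : Torus)) '' Icc ((j : ℝ) / 2 ^ n) (j / 2 ^ n + 1 / 2 ^ n),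
        psiSum 0 n x) = (s : EReal) ∧
      |s + 2 * Real.log ((edgeDist n j : ℝ) + 1)| ≤ 2 * Real.log Real.pi := by
    intro j
    by_cases hj : j < 2 ^ n
    · obtain ⟨s, hs⟩ := exists_iSup_psiSum_eq hj
      exact ⟨s, fun _ => hs⟩
    · exact ⟨0, fun h => absurd h hj⟩
  choose s hs using hsup
  have hexp : ∀ j < 2 ^ n, |t * s j - -(2 * t) * Real.log ((edgeDist n j : ℝ) + 1)| ≤
      2 * |t| * Real.log Real.pi := by
    intro j hj
    rw [show t * s j - -(2 * t) * Real.log ((edgeDist n j : ℝ) + 1) =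
      t * (s j + 2 * Real.log ((edgeDist n j : ℝ) + 1)) by ring, abs_mul]
    have := mul_le_mul_of_nonneg_left (hs j hj).2 (abs_nonneg t)
    linarith
  refine ⟨∑ j ∈ Finset.range (2 ^ n), Real.exp (t * s j), ?_, ?_, ?_⟩
  · have hsum := sum_wordVal n fun a : ℝ => eexp ((t : EReal) *
      ⨆ x ∈ (fun x : ℝ => (x : Torus)) '' Icc a (a + 1 / 2 ^ n), psiSum 0 n x)
    rw [presZ, ENNReal.ofReal_sum_of_nonneg fun _ _ => (Real.exp_pos _).le]
    refine hsum.trans (Finset.sum_congr rfl fun j hj => ?_)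
    rw [(hs j (Finset.mem_range.1 hj)).1, ← EReal.coe_mul, eexp, if_neg (EReal.coe_ne_bot _),
      if_neg (EReal.coe_ne_top _), EReal.toReal_coe]
  · rw [edgeSum, Finset.mul_sum]
    refine Finset.sum_le_sum fun j hj => ?_
    rw [← Real.exp_add]
    exact Real.exp_le_exp.2 (by linarith [(abs_le.1 (hexp j (Finset.mem_range.1 hj))).1])
  · rw [edgeSum, Finset.mul_sum]
    refine Finset.sum_le_sum fun j hj => ?_
    rw [← Real.exp_add]
    exact Real.exp_le_exp.2 (by linarith [(abs_le.1 (hexp j (Finset.mem_range.1 hj))).2])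

theorem exists_presZ_bounds (t : ℝ) :
    ∃ C : ℝ, ∀ n : ℕ, 2 ≤ n → ∃ z : ℝ, 0 < z ∧ presZ 0 t n = ENNReal.ofReal z ∧
      n * rate t - C ≤ Real.log z ∧ Real.log z ≤ n * rate t + C + Real.log (n + 1) := by
  refine ⟨2 * |t| * Real.log Real.pi + 2 * |t| * Real.log 2 + 2 * rate t + Real.log 2, ?_⟩
  intro n hn
  have hrate : 0 ≤ rate t := le_max_right _ _
  have hlog := Real.log_pos one_lt_two
  obtain ⟨k, rfl⟩ := Nat.exists_eq_add_of_le' hn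
  obtain ⟨z, hz, hlo, hhi⟩ := exists_presZ_eq t (k + 2)
  have hlo' :
      Real.exp (-(2 * |t| * Real.log Real.pi) + (k * rate t - 2 * |t| * Real.log 2)) ≤ z := by
    rw [Real.exp_add]
    refine le_trans (mul_le_mul_of_nonneg_left ?_ (Real.exp_pos _).le) hlo
    exact (le_dirichletSum_succ t k).trans (dirichletSum_le_edgeSum_succ t (k + 1))
  have hz₀ : 0 < z := (Real.exp_pos _).trans_le hlo'
  refine ⟨z, hz₀, hz, ?_, ?_⟩
  · have := (Real.le_log_iff_exp_le hz₀).2 hlo'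
    push_cast
    linarith
  · have hhi' : z ≤ Real.exp (2 * |t| * Real.log Real.pi) * (2 * ((((k + 2 : ℕ) : ℝ) + 1) *
        Real.exp ((k + 2 : ℕ) * rate t + 2 * |t| * Real.log 2))) := by
      refine hhi.trans (mul_le_mul_of_nonneg_left ?_ (Real.exp_pos _).le)
      exact (edgeSum_le t _).trans (mul_le_mul_of_nonneg_left (dirichletSum_le t _) two_pos.le)
    have := Real.log_le_log hz₀ hhi'
    have hk : (((k + 2 : ℕ) : ℝ) + 1) ≠ 0 := by positivity
    rw [Real.log_mul (Real.exp_ne_zero _) (by positivity), Real.log_mul two_ne_zero (by positivity),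
      Real.log_mul hk (Real.exp_ne_zero _), Real.log_exp, Real.log_exp] at this
    linarith

theorem tendsto_log_succ_div : Tendsto (fun n : ℕ => Real.log ((n : ℝ) + 1) / n) atTop (𝓝 0) := by
  have h₁ : Tendsto (fun n : ℕ => Real.log ((n : ℝ) + 1) / ((n : ℝ) + 1)) atTop (𝓝 0) := by
    have := Real.isLittleO_log_id_atTop.tendsto_div_nhds_zero
    exact this.comp (tendsto_atTop_add_const_right _ 1 tendsto_natCast_atTop_atTop)
  have h₂ : Tendsto (fun n : ℕ => 1 + 1 / (n : ℝ)) atTop (𝓝 (1 + 0)) :=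
    tendsto_const_nhds.add tendsto_one_div_atTop_nhds_zero_nat
  have h₃ := h₁.mul h₂
  rw [zero_mul] at h₃
  refine h₃.congr' ?_
  filter_upwards [eventually_gt_atTop 0] with n hn
  have : (0 : ℝ) < n := by exact_mod_cast hn
  field_simp

theorem tendsto_presZ (t : ℝ) :
    Tendsto (fun n : ℕ => (((n : ℝ)⁻¹ : ℝ) : EReal) * elog (presZ 0 t n)) atTop
      (𝓝 ((rate t : ℝ) : EReal)) := by
  obtain ⟨C, hC⟩ := exists_presZ_bounds t
  have hCn : Tendsto (fun n : ℕ => C / (n : ℝ)) atTop (𝓝 0) :=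
    tendsto_const_div_atTop_nhds_zero_nat C
  have hlo : Tendsto (fun n : ℕ => ((rate t - C / n : ℝ) : EReal)) atTop (𝓝 (rate t : ℝ)) :=
    EReal.tendsto_coe.2 (by simpa using hCn.const_sub (rate t))
  have hhi : Tendsto (fun n : ℕ => ((rate t + C / n + Real.log ((n : ℝ) + 1) / n : ℝ) : EReal))
      atTop (𝓝 (rate t : ℝ)) :=
    EReal.tendsto_coe.2 (by simpa using (hCn.const_add (rate t)).add tendsto_log_succ_div)
  have hbounds : ∀ n : ℕ, 2 ≤ n →
      ((rate t - C / n : ℝ) : EReal) ≤ (((n : ℝ)⁻¹ : ℝ) : EReal) * elog (presZ 0 t n) ∧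
      (((n : ℝ)⁻¹ : ℝ) : EReal) * elog (presZ 0 t n) ≤
        ((rate t + C / n + Real.log ((n : ℝ) + 1) / n : ℝ) : EReal) := by
    intro n hn
    obtain ⟨z, hz₀, hz, h₁, h₂⟩ := hC n hn
    have hn₀ : (0 : ℝ) < n := by exact_mod_cast two_pos.trans_le hn
    rw [hz, elog, if_neg (ENNReal.ofReal_pos.2 hz₀).ne', if_neg ENNReal.ofReal_ne_top,
      ENNReal.toReal_ofReal hz₀.le, ← EReal.coe_mul, EReal.coe_le_coe_iff, EReal.coe_le_coe_iff,
      inv_mul_eq_div, le_div_iff₀ hn₀, div_le_iff₀ hn₀]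
    constructor
    · rw [sub_mul, div_mul_cancel₀ _ hn₀.ne']
      linarith
    · rw [add_mul, add_mul, div_mul_cancel₀ _ hn₀.ne', div_mul_cancel₀ _ hn₀.ne']
      linarith
  refine tendsto_of_tendsto_of_tendsto_of_le_of_le' hlo hhi ?_ ?_ <;>
    filter_upwards [eventually_ge_atTop 2] with n hn
  exacts [(hbounds n hn).1, (hbounds n hn).2]

theorem stmt0 (t : ℝ) :
    presUpper 0 t = presLower 0 t ∧
      presUpper 0 t = ((max ((1 - 2 * t) * Real.log 2) 0 : ℝ) : EReal) := by
  have h := tendsto_presZ t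
  exact ⟨h.limsup_eq.trans h.liminf_eq.symm, h.limsup_eq⟩

end GTM
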